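/- Let 𝒜 = { (0,0,z) : z ∈ ℝ } be the z-axis in ℝ³, and let f : ℝ³ \ 𝒜 → ℝ be continuous, satisfy 0 ≤ f ≤ 1, be subharmonic in the distributional sense on ℝ³ \ 𝒜 (i.e., ∫ f Δφ ≥ 0 for all nonnegative smooth compactly supported φ on ℝ³ \ 𝒜), and tend to 0 at infinity: f(x) → 0 as |x| → ∞ with x ∈ ℝ³ \ 𝒜. Then f ≡ 0 on ℝ³ \ 𝒜. -/

import Mathlib

open MeasureTheory

/-- `i`-th partial derivative of a map on `ℝⁿ`. -/
noncomputable def pd {n : ℕ} {E : Type*} [NormedAddCommGroup E] [NormedSpace ℝ E]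
    (f : (Fin n → ℝ) → E) (i : Fin n) (x : Fin n → ℝ) : E :=
  fderiv ℝ f x (Pi.single i 1)


lemma pd_conv (K F : (Fin 3 → ℝ) → ℝ) (hK : ContDiff ℝ (⊤ : ℕ∞) K) (hc : HasCompactSupport K)
    (hF : LocallyIntegrable F volume) (i : Fin 3) :
    pd (convolution K F (ContinuousLinearMap.lsmul ℝ ℝ) volume) i
      = convolution (pd K i) F (ContinuousLinearMap.lsmul ℝ ℝ) volume := by
  funext x
  have h := hc.hasFDerivAt_convolution_left (ContinuousLinearMap.lsmul ℝ ℝ) (μ := volume)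
    (hK.of_le (by exact_mod_cast le_top)) hF x
  unfold pd
  rw [h.fderiv]
  have hce : ConvolutionExistsAt (fderiv ℝ K) F x
      (ContinuousLinearMap.precompL (Fin 3 → ℝ) (ContinuousLinearMap.lsmul ℝ ℝ : ℝ →L[ℝ] ℝ →L[ℝ] ℝ)) volume :=
    (hc.fderiv ℝ).convolutionExists_left _ (hK.continuous_fderiv (by simp)) hF x
  unfold convolution
  rw [ContinuousLinearMap.integral_apply hce]
  rfl

lemma pd_contDiff (K : (Fin 3 → ℝ) → ℝ) (hK : ContDiff ℝ (⊤ : ℕ∞) K) (i : Fin 3) :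
    ContDiff ℝ (⊤ : ℕ∞) (pd K i) := by
  unfold pd
  exact (hK.fderiv_right (m := (⊤ : ℕ∞)) (by simp)).clm_apply contDiff_const

lemma pd_hcs (K : (Fin 3 → ℝ) → ℝ) (hc : HasCompactSupport K) (i : Fin 3) :
    HasCompactSupport (pd K i) := by
  unfold pd
  exact hc.fderiv_apply ℝ _

lemma pd_refl (K : (Fin 3 → ℝ) → ℝ) (hK : ContDiff ℝ (⊤ : ℕ∞) K) (x : Fin 3 → ℝ) (i : Fin 3) :
    pd (fun y => K (x - y)) i = fun y => - pd K i (x - y) := by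
  funext y
  unfold pd
  have h1 : HasFDerivAt (fun y : Fin 3 → ℝ => x - y)
      (-(ContinuousLinearMap.id ℝ (Fin 3 → ℝ))) y := (hasFDerivAt_id y).const_sub x
  have h2 := ((hK.differentiable (by simp)) (x - y)).hasFDerivAt
  have h3 := h2.comp y h1
  erw [h3.fderiv]
  simp

lemma pd_neg (K : (Fin 3 → ℝ) → ℝ) (i : Fin 3) (y) :
    pd (fun y => - K y) i y = - pd K i y := by
  unfold pd
  rw [fderiv_fun_neg]; rfl

lemma locmax (u : (Fin 3 → ℝ) → ℝ) (hu : ContDiff ℝ (⊤ : ℕ∞) u) (x : Fin 3 → ℝ)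
    (hx : IsLocalMax u x) : ∑ i, pd (pd u i) i x ≤ 0 := by
  refine Finset.sum_nonpos fun i _ => ?_
  by_contra! hpos
  have hline : ∀ v : (Fin 3 → ℝ) → ℝ, ContDiff ℝ (⊤ : ℕ∞) v → 
      deriv (fun t : ℝ => v (x + t • Pi.single i 1)) = fun t => pd v i (x + t • Pi.single i 1) := by
    intro v hv
    funext t
    have h1 : HasDerivAt (fun t : ℝ => x + t • (Pi.single i 1 : Fin 3 → ℝ)) (Pi.single i 1) t := by
      simpa using ((hasDerivAt_id t).smul_const (Pi.single i 1 : Fin 3 → ℝ)).const_add x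
    have h2 := ((hv.differentiable (by simp)) (x + t • Pi.single i 1)).hasFDerivAt
    exact (h2.comp_hasDerivAt t h1).deriv
  set h : ℝ → ℝ := fun t : ℝ => u (x + t • Pi.single i 1) with hh
  have hcl : Continuous (fun t : ℝ => x + t • (Pi.single i 1 : Fin 3 → ℝ)) := by fun_prop
  have hmax : IsLocalMax h 0 := by
    have : Filter.Tendsto (fun t : ℝ => x + t • (Pi.single i 1 : Fin 3 → ℝ)) (nhds 0) (nhds x) := by
      simpa using hcl.tendsto 0
    simpa [IsLocalMax, IsMaxFilter, hh] using this.eventually hx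
  have h2 : deriv (deriv h) 0 = pd (pd u i) i x := by
    rw [hline u hu, hline _ (pd_contDiff u hu i)]; simp
  have hmin : IsLocalMin h 0 := by
    apply isLocalMin_of_deriv_deriv_pos (by rw [h2]; exact hpos) hmax.deriv_eq_zero
    exact (hu.continuous.comp hcl).continuousAt
  have hconst : h =ᶠ[nhds 0] fun _ => h 0 := by
    filter_upwards [hmax, hmin] with t a b using le_antisymm a b
  have : deriv (deriv h) 0 = 0 := by
    rw [hconst.deriv.deriv_eq]; simp
  linarith

lemma barrier (c : ℝ) (hc : 0 < c) :
    ContDiff ℝ (⊤ : ℕ∞) (fun x : Fin 3 → ℝ => Real.log (x 0 ^ 2 + x 1 ^ 2 + c)) ∧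
    ∀ x, 0 < ∑ i, pd (pd (fun x : Fin 3 → ℝ => Real.log (x 0 ^ 2 + x 1 ^ 2 + c)) i) i x := by
  have hq : ∀ x : Fin 3 → ℝ, x 0 ^ 2 + x 1 ^ 2 + c ≠ 0 := fun x => by positivity
  refine ⟨ContDiff.log (by fun_prop) hq, fun x => ?_⟩
  have hp : ∀ (j : Fin 3) (x : Fin 3 → ℝ), HasFDerivAt (fun x : Fin 3 → ℝ => x j)
      (ContinuousLinearMap.proj (R := ℝ) (φ := fun _ : Fin 3 => ℝ) j) x := fun j x =>
    (ContinuousLinearMap.proj (R := ℝ) (φ := fun _ : Fin 3 => ℝ) j).hasFDerivAt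
  have hQ := fun x => (((hp 0 x).pow 2).add ((hp 1 x).pow 2)).add_const c
  have h1 : ∀ i, pd (fun x : Fin 3 → ℝ => Real.log (x 0 ^ 2 + x 1 ^ 2 + c)) i = fun x => 
     (2 * x 0 * (Pi.single i 1 : Fin 3 → ℝ) 0 + 2 * x 1 * (Pi.single i 1 : Fin 3 → ℝ) 1) * (x 0 ^ 2 + x 1 ^ 2 + c)⁻¹ := by
    intro i; funext x
    have := (hQ x).log (hq x)
    unfold pd
    erw [this.fderiv]
    simp
    ring
  have h2 : ∀ i, pd (pd (fun x : Fin 3 → ℝ => Real.log (x 0 ^ 2 + x 1 ^ 2 + c)) i) i x = 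
     (2 * (Pi.single i 1 : Fin 3 → ℝ) 0 ^ 2 + 2 * (Pi.single i 1 : Fin 3 → ℝ) 1 ^ 2) * (x 0 ^ 2 + x 1 ^ 2 + c)⁻¹
      - (2 * x 0 * (Pi.single i 1 : Fin 3 → ℝ) 0 + 2 * x 1 * (Pi.single i 1 : Fin 3 → ℝ) 1) ^ 2 * ((x 0 ^ 2 + x 1 ^ 2 + c)⁻¹) ^ 2 := by
    intro i
    rw [h1]
    have := ((((hp 0 x).const_mul 2).mul_const ((Pi.single i 1 : Fin 3 → ℝ) 0)).add
      (((hp 1 x).const_mul 2).mul_const ((Pi.single i 1 : Fin 3 → ℝ) 1))).mul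
       ((hasDerivAt_inv (hq x)).comp_hasFDerivAt x (hQ x))
    unfold pd
    erw [this.fderiv]
    simp
    ring
  simp only [h2, Fin.sum_univ_three]
  have e : (4 * c) * ((x 0 ^ 2 + x 1 ^ 2 + c)⁻¹) ^ 2 > 0 := by positivity
  convert e using 1
  have := hq x
  simp
  field_simp
  ring

lemma pd_lin (g b : (Fin 3 → ℝ) → ℝ) (hg : ContDiff ℝ (⊤ : ℕ∞) g) (hb : ContDiff ℝ (⊤ : ℕ∞) b)
    (a : ℝ) (i : Fin 3) :
    pd (fun x => g x + a * b x) i = fun x => pd g i x + a * pd b i x := by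
  funext x
  have h1 := ((hg.differentiable (by simp)) x).hasFDerivAt
  have h2 := ((hb.differentiable (by simp)) x).hasFDerivAt
  have h3 := h1.add (h2.const_mul a)
  unfold pd
  erw [h3.fderiv]
  simp

/-- comparison for smooth functions -/
lemma compare (g : (Fin 3 → ℝ) → ℝ) (hg : ContDiff ℝ (⊤ : ℕ∞) g) (ε δ R : ℝ)
    (hε : 0 < ε) (hε1 : ε ≤ 1) (hδ : 0 < δ)
    (hsub : ∀ x : Fin 3 → ℝ, 4 * ε ^ 2 < x 0 ^ 2 + x 1 ^ 2 → 0 ≤ ∑ i, pd (pd g i) i x)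
    (h1 : ∀ x, g x ≤ 1) (hR : ∀ x, ‖x‖ = R → g x ≤ δ) (x : Fin 3 → ℝ) (hx : ‖x‖ ≤ R)
    (hxε : 4 * ε ^ 2 ≤ x 0 ^ 2 + x 1 ^ 2) :
    g x ≤ δ + Real.log ((2 * R ^ 2 + 6) / (x 0 ^ 2 + x 1 ^ 2 + ε ^ 2)) /
      Real.log ((2 * R ^ 2 + 6) / (5 * ε ^ 2)) := by
  set M := 2 * R ^ 2 + 6 with hM
  have hMp : 0 < M := by positivity
  have hL : 0 < Real.log (M / (5 * ε ^ 2)) := by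
    apply Real.log_pos
    rw [lt_div_iff₀ (by positivity)]
    nlinarith [sq_nonneg R]
  set a := (Real.log (M / (5 * ε ^ 2)))⁻¹ with ha
  have hap : 0 < a := inv_pos.2 hL
  have haL : a * (Real.log M - Real.log (5 * ε ^ 2)) = 1 := by
    rw [← Real.log_div (by positivity) (by positivity), ha]
    exact inv_mul_cancel₀ hL.ne'
  obtain ⟨hbs, hbl⟩ := barrier (ε ^ 2) (by positivity)
  set b : (Fin 3 → ℝ) → ℝ := fun x => Real.log (x 0 ^ 2 + x 1 ^ 2 + ε ^ 2) with hb
  have hus : ContDiff ℝ (⊤ : ℕ∞) (fun x => g x + a * b x) := hg.add (contDiff_const.mul hbs)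
  set u : (Fin 3 → ℝ) → ℝ := fun x => g x + a * b x with hu
  rw [Real.log_div (by positivity) (by positivity), div_eq_mul_inv]
  suffices u x ≤ δ + a * Real.log M by
    simp only [hu, hb] at this
    linarith
  set S : Set (Fin 3 → ℝ) := Metric.closedBall 0 R ∩ {y | 4 * ε ^ 2 ≤ y 0 ^ 2 + y 1 ^ 2} with hS
  have hSc : IsCompact S := (isCompact_closedBall _ _).inter_right
    (isClosed_le (by fun_prop) (by fun_prop))
  have hxS : x ∈ S := ⟨by simpa using hx, hxε⟩
  obtain ⟨y, hyS, hy⟩ := hSc.exists_isMaxOn ⟨x, hxS⟩ hus.continuous.continuousOn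
  refine (hy hxS).trans ?_
  change u y ≤ _
  have hyR : ‖y‖ ≤ R := by simpa using hyS.1
  have hyε : 4 * ε ^ 2 ≤ y 0 ^ 2 + y 1 ^ 2 := hyS.2
  have hby : b y ≤ Real.log M := by
    apply Real.log_le_log (by positivity)
    have h0 : |y 0| ≤ R := (norm_le_pi_norm y 0).trans hyR
    have h1 : |y 1| ≤ R := (norm_le_pi_norm y 1).trans hyR
    have := sq_le_sq' (abs_le.1 h0).1 (abs_le.1 h0).2
    have := sq_le_sq' (abs_le.1 h1).1 (abs_le.1 h1).2
    nlinarith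
  have hmul := mul_le_mul_of_nonneg_left hby hap.le
  rcases hyR.eq_or_lt with e | l
  · have := hR y e
    simp only [hu]; linarith
  rcases hyε.eq_or_lt with e | l'
  · have h2 : b y = Real.log (5 * ε ^ 2) := by
      simp only [hb]; rw [← e]; ring_nf
    have := h1 y
    simp only [hu, h2]
    linarith
  exfalso
  have hmem : S ∈ nhds y := by
    refine Filter.inter_mem ?_ ?_
    · exact Metric.closedBall_mem_nhds_of_mem (by simpa using l)
    · exact Filter.mem_of_superset ((isOpen_lt (f := fun _ : Fin 3 → ℝ => 4 * ε ^ 2)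
        (g := fun y : Fin 3 → ℝ => y 0 ^ 2 + y 1 ^ 2) (by fun_prop) (by fun_prop)).mem_nhds l')
        (fun z hz => by
          have h : 4 * ε ^ 2 < z 0 ^ 2 + z 1 ^ 2 := hz
          exact h.le)
  have hle := locmax u hus y (hy.isLocalMax hmem)
  have he : ∀ i, pd (pd u i) i y = pd (pd g i) i y + a * pd (pd b i) i y := fun i => by
    rw [hu, pd_lin g b hg hbs, pd_lin _ _ (pd_contDiff g hg i) (pd_contDiff b hbs i)]
  simp only [he, Finset.sum_add_distrib, ← Finset.mul_sum] at hle
  have := hsub y l'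
  have := mul_pos hap (hbl y)
  linarith

theorem clw_maximum_principle
    (A : Set (Fin 3 → ℝ)) (hA : A = {p : Fin 3 → ℝ | p 0 = 0 ∧ p 1 = 0})
    (f : (Fin 3 → ℝ) → ℝ)
    (hcont : ContinuousOn f Aᶜ)
    (hbound : ∀ x ∈ Aᶜ, 0 ≤ f x ∧ f x ≤ 1)
    (hsub : ∀ φ : (Fin 3 → ℝ) → ℝ, ContDiff ℝ (⊤ : ℕ∞) φ → HasCompactSupport φ →
      tsupport φ ⊆ Aᶜ → (∀ x, 0 ≤ φ x) →
      0 ≤ ∫ x in Aᶜ, f x * (∑ i, pd (pd φ i) i x))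
    (hdecay : ∀ ε > 0, ∃ R : ℝ, ∀ x ∈ Aᶜ, R < ‖x‖ → |f x| < ε) :
    ∀ x ∈ Aᶜ, f x = 0 := by
  intro x hx
  have hAc : IsClosed A := by
    rw [hA]
    exact (isClosed_eq (by fun_prop) (by fun_prop)).inter (isClosed_eq (by fun_prop) (by fun_prop))
  have hAo : IsOpen Aᶜ := hAc.isOpen_compl
  classical
  set F : (Fin 3 → ℝ) → ℝ := Aᶜ.indicator f with hF
  have hFm : Measurable F := by
    rw [hF, ← Set.piecewise_eq_indicator]
    exact hcont.measurable_piecewise continuousOn_const hAo.measurableSet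
  have hFb : ∀ y, |F y| ≤ 1 := by
    intro y
    by_cases hy : y ∈ Aᶜ
    · rw [hF, Set.indicator_of_mem hy, abs_le]
      constructor <;> linarith [(hbound y hy).1, (hbound y hy).2]
    · rw [hF, Set.indicator_of_notMem hy]; simp
  have hFl : LocallyIntegrable F volume :=
    (locallyIntegrable_const (1 : ℝ)).mono hFm.aestronglyMeasurable
      (Filter.Eventually.of_forall fun y => by simpa using hFb y)
  have hFx : F x = f x := Set.indicator_of_mem hx _
  have hFc : ContinuousAt F x := by
    refine (hcont.continuousAt (hAo.mem_nhds hx)).congr ?_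
    filter_upwards [hAo.mem_nhds hx] with y hy
    exact (Set.indicator_of_mem hy _).symm
  have hρ : 0 < x 0 ^ 2 + x 1 ^ 2 := by
    have : ¬ (x 0 = 0 ∧ x 1 = 0) := by simpa [hA] using hx
    by_contra! h
    apply this
    constructor <;> nlinarith [sq_nonneg (x 0), sq_nonneg (x 1)]
  refine le_antisymm ?_ (hbound x hx).1
  suffices H : ∀ δ > 0, f x ≤ 3 * δ by
    refine le_of_forall_pos_le_add fun δ hδ => ?_
    have := H (δ / 3) (by positivity)
    linarith
  intro δ hδ
  obtain ⟨R₀, hR₀⟩ := hdecay δ hδ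
  set R := max (R₀ + 2) (‖x‖ + 1) with hR
  have hR1 : R₀ + 2 ≤ R := le_max_left _ _
  have hR2 : ‖x‖ + 1 ≤ R := le_max_right _ _
  set M := 2 * R ^ 2 + 6 with hM
  have hMp : 0 < M := by positivity
  -- choose ε
  obtain ⟨r, hr, hrF⟩ := Metric.continuousAt_iff.1 hFc δ hδ
  have hlim : Filter.Tendsto (fun ε : ℝ => Real.log (M / (5 * ε ^ 2))) (nhdsWithin 0 (Set.Ioi 0))
      Filter.atTop := by
    apply Real.tendsto_log_atTop.comp
    apply Filter.Tendsto.const_mul_atTop hMp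
    apply Filter.Tendsto.inv_tendsto_nhdsGT_zero
    refine tendsto_nhdsWithin_iff.2 ⟨?_, ?_⟩
    · have : Filter.Tendsto (fun ε : ℝ => 5 * ε ^ 2) (nhds 0) (nhds 0) := by
        have h : Continuous (fun ε : ℝ => 5 * ε ^ 2) := by fun_prop
        simpa using h.tendsto 0
      exact this.mono_left nhdsWithin_le_nhds
    · filter_upwards [self_mem_nhdsWithin] with ε hε
      have : (0:ℝ) < ε := hε
      exact Set.mem_Ioi.2 (by positivity)
  set C := Real.log (M / (x 0 ^ 2 + x 1 ^ 2)) with hC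
  have hsmall : ∀ s : ℝ, 0 < s → ∀ᶠ ε : ℝ in nhdsWithin 0 (Set.Ioi 0), ε < s := fun s hs =>
    nhdsWithin_le_nhds (gt_mem_nhds hs)
  have hsq : ∀ᶠ ε : ℝ in nhdsWithin 0 (Set.Ioi 0), 4 * ε ^ 2 < x 0 ^ 2 + x 1 ^ 2 := by
    have h : Continuous (fun ε : ℝ => 4 * ε ^ 2) := by fun_prop
    have : Filter.Tendsto (fun ε : ℝ => 4 * ε ^ 2) (nhds 0) (nhds 0) := by
      simpa using h.tendsto 0
    exact nhdsWithin_le_nhds (this.eventually (gt_mem_nhds hρ))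
  have hpos0 : ∀ᶠ ε : ℝ in nhdsWithin 0 (Set.Ioi 0), 0 < ε := self_mem_nhdsWithin
  obtain ⟨ε, hε0, hε1, hεr, hερ, hεL, hεL0⟩ := (hpos0.and ((hsmall 1 one_pos).and ((hsmall r hr).and (hsq.and
    ((hlim.eventually (Filter.eventually_ge_atTop (C / δ))).and
      (hlim.eventually (Filter.eventually_gt_atTop 0))))))).exists
  have hε : 0 < ε := hε0
  let φ : ContDiffBump (0 : Fin 3 → ℝ) := ⟨ε / 2, ε, by linarith, by linarith⟩
  have hφr : φ.rOut = ε := rfl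
  set K : (Fin 3 → ℝ) → ℝ := φ.normed volume with hK
  have hKs : ContDiff ℝ (⊤ : ℕ∞) K := φ.contDiff_normed
  have hKc : HasCompactSupport K := φ.hasCompactSupport_normed
  have hKn : ∀ y, 0 ≤ K y := fun y => φ.nonneg_normed y
  have hKi : ∫ y, K y = 1 := φ.integral_normed
  have hKsup : Function.support K ⊆ Metric.ball 0 ε := by
    rw [hK, φ.support_normed_eq]
  set g := convolution K F (ContinuousLinearMap.lsmul ℝ ℝ) volume with hg
  have hgs : ContDiff ℝ (⊤ : ℕ∞) g := hKc.contDiff_convolution_left _ hKs hFl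
  have key : ∀ (y : Fin 3 → ℝ) (z c : ℝ), 0 ≤ c → (∀ w ∈ Metric.ball y ε, dist (F w) z ≤ c) →
      dist (g y) z ≤ c := fun y z c hc h =>
    dist_convolution_le hc hKsup hKn hKi hFm.aestronglyMeasurable h
  have hg1 : ∀ y, g y ≤ 1 := fun y => by
    have := key y 0 1 zero_le_one (fun w _ => by simpa using hFb w)
    rw [Real.dist_eq, sub_zero] at this
    exact (abs_le.1 this).2
  have hgR : ∀ y, ‖y‖ = R → g y ≤ δ := fun y hy => by
    have := key y 0 δ hδ.le (fun w hw => by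
      rw [Real.dist_eq, sub_zero]
      by_cases hwA : w ∈ Aᶜ
      · rw [hF, Set.indicator_of_mem hwA]
        refine (hR₀ w hwA ?_).le
        rw [Metric.mem_ball, dist_comm, dist_eq_norm] at hw
        have := norm_sub_norm_le y w
        linarith
      · rw [hF, Set.indicator_of_notMem hwA]; simpa using hδ.le)
    rw [Real.dist_eq, sub_zero] at this
    exact (abs_le.1 this).2
  have hgx : f x - δ ≤ g x := by
    have := key x (F x) δ hδ.le (fun w hw => (hrF (lt_trans hw hεr)).le)
    rw [Real.dist_eq, hFx] at this
    linarith [(abs_le.1 this).1]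
  have hgsub : ∀ y : Fin 3 → ℝ, 4 * ε ^ 2 < y 0 ^ 2 + y 1 ^ 2 →
      0 ≤ ∑ i, pd (pd g i) i y := by
    intro y hy
    have hψs : ContDiff ℝ (⊤ : ℕ∞) (fun w => K (y - w)) :=
      hKs.comp (contDiff_const.sub contDiff_id)
    have hts : tsupport (fun w => K (y - w)) ⊆ Metric.closedBall y ε := by
      refine closure_minimal ?_ Metric.isClosed_closedBall
      intro w hw
      have := hKsup (show y - w ∈ Function.support K from hw)
      rw [mem_ball_zero_iff] at this
      rw [Metric.mem_closedBall, dist_comm, dist_eq_norm]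
      exact this.le
    have hψc : HasCompactSupport (fun w => K (y - w)) :=
      HasCompactSupport.of_support_subset_isCompact (isCompact_closedBall y ε)
        ((subset_tsupport _).trans hts)
    have hψA : tsupport (fun w => K (y - w)) ⊆ Aᶜ := by
      intro w hw hwA
      have hw := hts hw
      rw [Metric.mem_closedBall, dist_comm, dist_eq_norm] at hw
      rw [hA] at hwA
      have h0 := (norm_le_pi_norm (y - w) 0).trans hw
      have h1 := (norm_le_pi_norm (y - w) 1).trans hw
      rw [Real.norm_eq_abs, Pi.sub_apply, hwA.1, sub_zero] at h0
      rw [Real.norm_eq_abs, Pi.sub_apply, hwA.2, sub_zero] at h1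
      have := sq_le_sq' (abs_le.1 h0).1 (abs_le.1 h0).2
      have := sq_le_sq' (abs_le.1 h1).1 (abs_le.1 h1).2
      nlinarith
    have h := hsub _ hψs hψc hψA (fun w => hKn _)
    have hpp : ∀ i w, pd (pd (fun w => K (y - w)) i) i w = pd (pd K i) i (y - w) := by
      intro i w
      rw [pd_refl K hKs, pd_neg (fun w => pd K i (y - w)), pd_refl _ (pd_contDiff K hKs i)]
      simp
    have hgi : ∀ i, pd (pd g i) i y = ∫ w, pd (pd K i) i (y - w) * F w := by
      intro i
      rw [hg, pd_conv K F hKs hKc hFl, pd_conv _ F (pd_contDiff K hKs i) (pd_hcs K hKc i) hFl,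
        convolution_lsmul_swap]
      rfl
    have hint : ∀ i, Integrable (fun w => pd (pd K i) i (y - w) * F w) := by
      intro i
      have := ((pd_hcs _ (pd_hcs K hKc i) i).convolutionExists_left
        (ContinuousLinearMap.lsmul ℝ ℝ) (pd_contDiff _ (pd_contDiff K hKs i) i).continuous hFl y).integrable_swap
      exact this
    simp only [hgi]
    rw [← integral_finsetSum _ (fun i _ => hint i)]
    rw [← integral_indicator hAo.measurableSet] at h
    convert h using 2
    funext w
    by_cases hwA : w ∈ Aᶜ
    · rw [Set.indicator_of_mem hwA, hF, Set.indicator_of_mem hwA, Finset.mul_sum]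
      simp only [hpp, mul_comm]
    · rw [Set.indicator_of_notMem hwA, hF, Set.indicator_of_notMem hwA]
      simp
  have hfin := compare g hgs ε δ R hε hε1.le hδ hgsub hg1 hgR x (by linarith) hερ.le
  have hlog : Real.log (M / (x 0 ^ 2 + x 1 ^ 2 + ε ^ 2)) ≤ C := by
    apply Real.log_le_log (by positivity)
    exact div_le_div_of_nonneg_left hMp.le hρ (by linarith [sq_nonneg ε])
  have : Real.log (M / (x 0 ^ 2 + x 1 ^ 2 + ε ^ 2)) / Real.log (M / (5 * ε ^ 2)) ≤ δ := by
    rw [div_le_iff₀ hεL0]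
    rw [div_le_iff₀ hδ] at hεL
    linarith
  linarith
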